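/- arXiv:1304.5892 — 2 statements merged into one kernel-verified Lean document; each statement's English description precedes it below -/
import Mathlib

section
/- For two agents, p ≥ 1 items, Borda utilities, and every ε > 0: with probability at least 1 − ε over uniform independent profiles R, z_1(R)/z_2(R) > 1 − 1/(3pε), where z_1(R) is the utilitarian social welfare obtained by sequential allocation with the strictly alternating policy 1212… of length p, and z_2(R) = Σ over items of the maximum of the two agents' Borda utilities for that item (the welfare of the BestPref mechanism). -/
open Finset

namespace SeqAlloc

/-- Given an agent's ranking `r` (a bijection sending each item to its position,
position `0` being the most preferred), pick the most preferred item of a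
nonempty set `S` of remaining items. -/
def pickItem {p : ℕ} (r : Equiv.Perm (Fin p)) (S : Finset (Fin p)) (h : S.Nonempty) : Fin p :=
  r.symm ((S.image r).min' (h.image r))

/-- Sequential allocation: the agents in the list take turns; each takes her
most preferred remaining item.  Returns the list of (agent, item) pairs. -/
def allocList {n p : ℕ} (R : Fin n → Equiv.Perm (Fin p)) :
    List (Fin n) → Finset (Fin p) → List (Fin n × Fin p)
  | [], _ => []
  | a :: rest, S =>
    if h : S.Nonempty then
      (a, pickItem (R a) S h) :: allocList R rest (S.erase (pickItem (R a) S h))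
    else []

/-- The utility that agent `i` obtains when the items `Fin p` are allocated
sequentially according to the policy `π` under profile `R`, where an item
ranked in (1-indexed) position `k` by an agent is worth `g k` to her. -/
noncomputable def utilAgent {n p : ℕ} (g : ℕ → ℝ) (R : Fin n → Equiv.Perm (Fin p))
    (π : List (Fin n)) (i : Fin n) : ℝ :=
  ((allocList R π Finset.univ).map
    (fun x => if x.1 = i then g (((R i) x.2).val + 1) else 0)).sum

/-- The expected utility of agent `i` under policy `π` for `p` items and scoring
function `g`, the profiles being drawn uniformly and independently. -/
noncomputable def expectedUtil (n p : ℕ) (g : ℕ → ℝ) (π : List (Fin n)) (i : Fin n) : ℝ :=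
  (∑ R : Fin n → Equiv.Perm (Fin p), utilAgent g R π i) / ((p.factorial : ℝ) ^ n)

/-- Expected Borda utility: an item ranked (1-indexed) in position `k` is worth
`p - k + 1`. -/
noncomputable def expectedBordaUtil (n p : ℕ) (π : List (Fin n)) (i : Fin n) : ℝ :=
  expectedUtil n p (fun k => (p : ℝ) - k + 1) π i

/-- The strictly alternating policy `1212…` of length `p` for two agents. -/
def altPolicy (p : ℕ) : List (Fin 2) :=
  (List.range p).map (fun k => if k % 2 = 0 then 0 else 1)

end SeqAlloc

/-- The utilitarian social welfare `z₁(R)` obtained by sequential allocation of the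
`p` items with the strictly alternating policy `1212…` under profile `R`,
with Borda utilities. -/
noncomputable def swAlt (p : ℕ) (R : Fin 2 → Equiv.Perm (Fin p)) : ℝ :=
  SeqAlloc.utilAgent (fun k => (p : ℝ) - k + 1) R (SeqAlloc.altPolicy p) 0
    + SeqAlloc.utilAgent (fun k => (p : ℝ) - k + 1) R (SeqAlloc.altPolicy p) 1

/-- The welfare `z₂(R)` of the BestPref mechanism: the sum over items of the maximum
of the two agents' Borda utilities for that item (an item at 0-indexed rank `r` is
worth `p - r`). -/
noncomputable def swBest (p : ℕ) (R : Fin 2 → Equiv.Perm (Fin p)) : ℝ :=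
  ∑ x : Fin p, max ((p : ℝ) - ((R 0) x).val) ((p : ℝ) - ((R 1) x).val)

namespace SeqAlloc

/-- insert `x0 ↦ k` in a permutation -/
def comb {p : ℕ} (x0 k : Fin (p+1)) (r : Equiv.Perm (Fin p)) : Equiv.Perm (Fin (p+1)) :=
  (finSuccEquiv' x0).trans ((Equiv.optionCongr r).trans (finSuccEquiv' k).symm)

lemma comb_self {p : ℕ} (x0 k : Fin (p+1)) (r : Equiv.Perm (Fin p)) :
    comb x0 k r x0 = k := by
  simp [comb]

lemma comb_succAbove {p : ℕ} (x0 k : Fin (p+1)) (r : Equiv.Perm (Fin p)) (y : Fin p) :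
    comb x0 k r (x0.succAbove y) = k.succAbove (r y) := by
  simp [comb]

lemma comb_inj {p : ℕ} {x0 k : Fin (p+1)} {r r' : Equiv.Perm (Fin p)}
    (h : comb x0 k r = comb x0 k r') : r = r' := by
  ext1 y
  have := congrArg (fun e => e (x0.succAbove y)) h
  simpa [comb_succAbove] using this

lemma comb_bij {p : ℕ} (x0 : Fin (p+1)) :
    Function.Bijective (fun t : Fin (p+1) × Equiv.Perm (Fin p) => comb x0 t.1 t.2) := by
  rw [Fintype.bijective_iff_injective_and_card]
  constructor
  · rintro ⟨k, r⟩ ⟨k', r'⟩ h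
    simp only at h
    have hk : k = k' := by rw [← comb_self x0 k r, h, comb_self]
    subst hk
    rw [comb_inj h]
  · simp [Fintype.card_perm, Nat.factorial_succ]

/-- build a profile from the first pick -/
def build {p : ℕ} (a : Fin 2) (t : Fin (p+1) × Fin (p+1) × (Fin 2 → Equiv.Perm (Fin p))) :
    Fin 2 → Equiv.Perm (Fin (p+1)) :=
  fun i => comb t.1 (if i = a then 0 else t.2.1) (t.2.2 i)

lemma build_bij {p : ℕ} (a : Fin 2) : Function.Bijective (build (p := p) a) := by
  rw [Fintype.bijective_iff_injective_and_card]
  constructor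
  · rintro ⟨x, k, R⟩ ⟨x', k', R'⟩ h
    have hi : ∀ i, comb x (if i = a then 0 else k) (R i)
        = comb x' (if i = a then 0 else k') (R' i) := fun i => congrFun h i
    have hx : x = x' := by
      have h1 := hi a
      simp only [if_true] at h1
      apply (comb x 0 (R a)).injective
      rw [comb_self, h1, comb_self]
    subst hx
    have hk : k = k' := by
      have hne : a + 1 ≠ a := by clear h hi; revert a; decide
      have h1 := hi (a+1)
      simp only [hne, if_false] at h1
      rw [← comb_self x k (R (a+1)), h1, comb_self]
    subst hk
    have : R = R' := funext fun i => comb_inj (hi i)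
    rw [this]
  · simp [Fintype.card_perm, Nat.factorial_succ]
    ring

lemma pickItem_mem {p : ℕ} (r : Equiv.Perm (Fin p)) (S : Finset (Fin p)) (h : S.Nonempty) :
    pickItem r S h ∈ S := by
  have := (S.image r).min'_mem (h.image r)
  obtain ⟨x, hx, hx2⟩ := Finset.mem_image.1 this
  unfold pickItem
  rw [← hx2]; simpa using hx

lemma pickItem_eq {p : ℕ} (r : Equiv.Perm (Fin p)) (S : Finset (Fin p)) (h : S.Nonempty)
    (x : Fin p) (hx : x ∈ S) (hm : ∀ y ∈ S, r x ≤ r y) : pickItem r S h = x := by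
  unfold pickItem
  rw [Equiv.symm_apply_eq]
  apply le_antisymm
  · exact Finset.min'_le _ _ (Finset.mem_image_of_mem r hx)
  · apply Finset.le_min'
    intro y hy
    obtain ⟨z, hz, rfl⟩ := Finset.mem_image.1 hy
    exact hm z hz

lemma pickItem_le {p : ℕ} (r : Equiv.Perm (Fin p)) (S : Finset (Fin p)) (h : S.Nonempty)
    (y : Fin p) (hy : y ∈ S) : r (pickItem r S h) ≤ r y := by
  unfold pickItem
  rw [Equiv.apply_symm_apply]
  exact Finset.min'_le _ _ (Finset.mem_image_of_mem r hy)

lemma allocList_map {n p q : ℕ} (R : Fin n → Equiv.Perm (Fin q)) (R' : Fin n → Equiv.Perm (Fin p))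
    (f : Fin p ↪ Fin q) (hh : Fin n → Fin p → Fin q) (hmono : ∀ i, StrictMono (hh i))
    (hR : ∀ i y, R i (f y) = hh i (R' i y)) (π : List (Fin n)) : ∀ S : Finset (Fin p),
    allocList R π (S.map f) = (allocList R' π S).map (fun t => (t.1, f t.2)) := by
  induction π with
  | nil => intro S; simp [allocList]
  | cons a π ih =>
    intro S
    by_cases hS : S.Nonempty
    · have hS' : (S.map f).Nonempty := hS.map
      have hp : pickItem (R a) (S.map f) hS' = f (pickItem (R' a) S hS) := by
        apply pickItem_eq
        · exact Finset.mem_map_of_mem f (pickItem_mem _ _ _)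
        · intro y hy
          obtain ⟨z, hz, rfl⟩ := Finset.mem_map.1 hy
          rw [hR, hR]
          exact (hmono a).monotone (pickItem_le _ _ _ _ hz)
      rw [allocList, allocList, dif_pos hS', dif_pos hS, hp, ← Finset.map_erase, ih]
      simp
    · have hS' : ¬ (S.map f).Nonempty := by simpa using hS
      rw [allocList, allocList, dif_neg hS', dif_neg hS]
      simp

/-- list utility with weights on positions -/
noncomputable def lu {p : ℕ} (w : Fin p → ℝ) (R : Fin 2 → Equiv.Perm (Fin p))
    (π : List (Fin 2)) (i : Fin 2) : ℝ :=
  ((allocList R π Finset.univ).map (fun x => if x.1 = i then w (R i x.2) else 0)).sum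

lemma lu_build {p : ℕ} (w : Fin (p+1) → ℝ) (a : Fin 2) (x k : Fin (p+1))
    (R : Fin 2 → Equiv.Perm (Fin p)) (π : List (Fin 2)) (i : Fin 2) :
    lu w (build a (x, k, R)) (a :: π) i =
      (if a = i then w 0 else 0) +
        lu (fun j => w ((if i = a then 0 else k : Fin (p+1)).succAbove j)) R π i := by
  have hne : (Finset.univ : Finset (Fin (p+1))).Nonempty := Finset.univ_nonempty
  have hp : pickItem (build a (x, k, R) a) Finset.univ hne = x := by
    apply pickItem_eq _ _ _ _ (Finset.mem_univ _)
    intro y _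
    simp [build, comb_self]
  have hS : (Finset.univ : Finset (Fin (p+1))).erase x
      = (Finset.univ : Finset (Fin p)).map (Fin.succAboveEmb x) := by
    ext y
    simp only [Finset.mem_erase, Finset.mem_univ, and_true, Finset.mem_map, true_and]
    exact Fin.exists_succAbove_eq_iff.symm
  unfold lu
  rw [allocList, dif_pos hne, hp, hS, allocList_map _ R _
    (fun i => (if i = a then 0 else k : Fin (p+1)).succAbove)
    (fun i => Fin.strictMono_succAbove _) (fun i y => by simp [build, comb_succAbove])]
  rw [List.map_cons, List.sum_cons, List.map_map]
  congr 1
  · split_ifs with h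
    · subst h; simp [build, comb_self]
    · rfl
  · congr 2
    funext t
    simp [build, comb_succAbove]

lemma lu_sum {p : ℕ} {ι : Type*} (s : Finset ι) (w : ι → Fin p → ℝ)
    (R : Fin 2 → Equiv.Perm (Fin p)) (π : List (Fin 2)) (i : Fin 2) :
    ∑ k ∈ s, lu (w k) R π i = lu (fun j => ∑ k ∈ s, w k j) R π i := by
  unfold lu
  generalize allocList R π Finset.univ = l
  induction l with
  | nil => simp
  | cons t l ih =>
    simp only [List.map_cons, List.sum_cons, Finset.sum_add_distrib, ih]
    congr 1
    split_ifs <;> simp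

lemma lu_mul {p : ℕ} (c : ℝ) (w : Fin p → ℝ)
    (R : Fin 2 → Equiv.Perm (Fin p)) (π : List (Fin 2)) (i : Fin 2) :
    lu (fun j => c * w j) R π i = c * lu w R π i := by
  unfold lu
  rw [← List.sum_map_mul_left]
  congr 2
  funext t
  split_ifs <;> simp

/-- Borda weights -/
noncomputable def bw (p : ℕ) (j : Fin p) : ℝ := (p : ℝ) - (j.val : ℝ)

lemma bw_succ (p : ℕ) (j : Fin p) : bw (p+1) ((0 : Fin (p+1)).succAbove j) = bw p j := by
  simp [bw]

lemma bw_sum (p : ℕ) (j : Fin p) :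
    ∑ k : Fin (p+1), bw (p+1) (k.succAbove j) = ((p : ℝ) + 2) * bw p j := by
  have h1 : ∀ k : Fin (p+1), bw (p+1) (k.succAbove j)
      = ((p : ℝ) + 1 - j.val) - (if k.val < j.val + 1 then 1 else 0) := by
    intro k
    unfold bw Fin.succAbove
    simp only [Fin.lt_def, Fin.val_castSucc]
    split_ifs <;> first | omega | (push_cast; simp; try ring)
  simp_rw [h1]
  rw [Finset.sum_sub_distrib, Finset.sum_boole]
  have : (Finset.univ.filter (fun k : Fin (p+1) => k.val < j.val + 1)).card = j.val + 1 := by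
    rw [Fin.card_filter_val_lt]
    have := j.2
    omega
  rw [this]
  simp [bw]
  ring

/-- total Borda utility over all profiles -/
noncomputable def U (p : ℕ) (π : List (Fin 2)) (i : Fin 2) : ℝ :=
  ∑ R : Fin 2 → Equiv.Perm (Fin p), lu (bw p) R π i

lemma U_cons (p : ℕ) (w : Fin (p+1) → ℝ) (a : Fin 2) (π : List (Fin 2)) (i : Fin 2) :
    ∑ R : Fin 2 → Equiv.Perm (Fin (p+1)), lu w R (a :: π) i =
    ∑ x : Fin (p+1), ∑ k : Fin (p+1), ∑ R : Fin 2 → Equiv.Perm (Fin p),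
      ((if a = i then w 0 else 0) +
        lu (fun j => w ((if i = a then 0 else k : Fin (p+1)).succAbove j)) R π i) := by
  rw [← (build_bij a).sum_comp]
  rw [Fintype.sum_prod_type]
  refine Finset.sum_congr rfl fun x _ => ?_
  rw [Fintype.sum_prod_type]
  simp only [lu_build]

lemma U_self (p : ℕ) (a : Fin 2) (π : List (Fin 2)) :
    U (p+1) (a :: π) a = ((p : ℝ)+1)^2 * ((p.factorial : ℝ)^2 * ((p : ℝ)+1) + U p π a) := by
  unfold U
  rw [U_cons]
  simp only [if_true, bw_succ, Finset.sum_add_distrib, Finset.sum_const, Finset.card_univ,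
    Fintype.card_fin, nsmul_eq_mul, Fintype.card_pi, Fintype.card_perm, Finset.prod_const]
  have hb : bw (p+1) 0 = (p : ℝ) + 1 := by simp [bw]
  rw [hb]
  push_cast
  ring

lemma U_other (p : ℕ) (a i : Fin 2) (h : i ≠ a) (π : List (Fin 2)) :
    U (p+1) (a :: π) i = ((p : ℝ)+1) * ((p : ℝ)+2) * U p π i := by
  unfold U
  rw [U_cons]
  simp only [if_neg h, if_neg h.symm, zero_add]
  rw [Finset.sum_const, Finset.sum_comm]
  simp only [lu_sum, bw_sum, lu_mul]
  rw [← Finset.mul_sum]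
  simp
  ring

/-- alternating list starting from `a` -/
def altFrom (a : Fin 2) : ℕ → List (Fin 2)
  | 0 => []
  | (p+1) => a :: altFrom (a+1) p

lemma altFrom_eq (p : ℕ) : ∀ a : Fin 2,
    (List.range p).map (fun k => if k % 2 = 0 then a else a + 1) = altFrom a p := by
  induction p with
  | zero => intro a; simp [altFrom]
  | succ p ih =>
    intro a
    rw [List.range_succ_eq_map, altFrom, ← ih (a+1)]
    simp only [List.map_cons, List.map_map]
    congr 1
    apply List.map_congr_left
    intro k _
    have h2 : a + 1 + 1 = a := by revert a; decide
    simp only [Function.comp, h2]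
    split_ifs <;> first | rfl | (exfalso; omega)

lemma U_bound (p : ℕ) : ∀ a : Fin 2,
    (p.factorial : ℝ)^2 * ((p : ℝ) * (p+1) / 3) ≤ U p (altFrom a p) a ∧
    (p.factorial : ℝ)^2 * (((p : ℝ)^2 - 1) / 3) ≤ U p (altFrom a p) (a+1) := by
  induction p with
  | zero => intro a; simp [U, lu, altFrom, allocList]; norm_num
  | succ p ih =>
    intro a
    have hne : a + 1 ≠ a := by revert a; decide
    have h2 : a + 1 + 1 = a := by revert a; decide
    obtain ⟨h3, h4⟩ := ih (a+1)
    rw [h2] at h4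
    rw [altFrom, U_self, U_other _ _ _ hne, Nat.factorial_succ]
    push_cast
    constructor
    · calc _ = ((p : ℝ)+1)^2 * ((p.factorial : ℝ)^2 * ((p : ℝ)+1)
            + (p.factorial : ℝ)^2 * (((p : ℝ)^2 - 1) / 3)) := by ring
        _ ≤ _ := by gcongr
    · calc _ = ((p : ℝ)+1) * ((p : ℝ)+2) * ((p.factorial : ℝ)^2 * ((p : ℝ) * (p+1) / 3)) := by ring
        _ ≤ _ := by gcongr

lemma util_eq (p : ℕ) (R : Fin 2 → Equiv.Perm (Fin p)) (π : List (Fin 2)) (i : Fin 2) :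
    utilAgent (fun k => (p : ℝ) - k + 1) R π i = lu (bw p) R π i := by
  unfold utilAgent lu bw
  congr 2
  funext t
  split_ifs
  · push_cast; ring
  · rfl

lemma sw_eq (p : ℕ) (R : Fin 2 → Equiv.Perm (Fin p)) :
    swAlt p R = lu (bw p) R (altFrom 0 p) 0 + lu (bw p) R (altFrom 0 p) 1 := by
  have : altPolicy p = altFrom 0 p := by rw [← altFrom_eq]; simp [altPolicy]
  rw [swAlt, util_eq, util_eq, this]

lemma sum_swAlt (p : ℕ) :
    (p.factorial : ℝ)^2 * ((2 * (p : ℝ) - 1) * (p+1) / 3) ≤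
      ∑ R : Fin 2 → Equiv.Perm (Fin p), swAlt p R := by
  simp only [sw_eq, Finset.sum_add_distrib]
  have h := U_bound p 0
  unfold U at h
  rw [zero_add] at h
  linarith [h.1, h.2]

lemma bw_nonneg (p : ℕ) (j : Fin p) : 0 ≤ bw p j := by
  unfold bw
  have : (j.val : ℝ) ≤ p := by exact_mod_cast j.2.le
  linarith

lemma alloc_le {p : ℕ} (R : Fin 2 → Equiv.Perm (Fin p)) (π : List (Fin 2)) :
    ∀ S : Finset (Fin p),
    ((allocList R π S).map (fun x => if x.1 = 0 then bw p (R 0 x.2) else 0)).sum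
    + ((allocList R π S).map (fun x => if x.1 = 1 then bw p (R 1 x.2) else 0)).sum
    ≤ ∑ x ∈ S, max (bw p (R 0 x)) (bw p (R 1 x)) := by
  have hnn : ∀ S : Finset (Fin p), 0 ≤ ∑ x ∈ S, max (bw p (R 0 x)) (bw p (R 1 x)) :=
    fun S => Finset.sum_nonneg fun x _ => le_max_of_le_left (bw_nonneg _ _)
  induction π with
  | nil => intro S; simpa [allocList] using hnn S
  | cons a π ih =>
    intro S
    by_cases hS : S.Nonempty
    · rw [allocList, dif_pos hS]
      have h1 := ih (S.erase (pickItem (R a) S hS))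
      rw [← Finset.add_sum_erase _ _ (pickItem_mem (R a) S hS)]
      simp only [List.map_cons, List.sum_cons]
      generalize pickItem (R a) S hS = y at *
      have h2 := le_max_left (bw p (R 0 y)) (bw p (R 1 y))
      have h3 := le_max_right (bw p (R 0 y)) (bw p (R 1 y))
      fin_cases a <;> simp <;> linarith
    · rw [allocList, dif_neg hS]
      simpa using hnn S

lemma swBest_eq (p : ℕ) (R : Fin 2 → Equiv.Perm (Fin p)) :
    swBest p R = ∑ x, max (bw p (R 0 x)) (bw p (R 1 x)) := rfl

lemma sw_le (p : ℕ) (R : Fin 2 → Equiv.Perm (Fin p)) : swAlt p R ≤ swBest p R := by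
  rw [sw_eq, swBest_eq]
  exact alloc_le R _ _

lemma sum_bw (p : ℕ) : ∑ k : Fin p, bw p k = (p : ℝ) * (p+1) / 2 := by
  induction p with
  | zero => simp
  | succ p ih =>
    rw [Fin.sum_univ_succ]
    simp only [← Fin.zero_succAbove, bw_succ, ih]
    simp [bw]; ring

lemma swBest_ge (p : ℕ) (R : Fin 2 → Equiv.Perm (Fin p)) : (p : ℝ) * (p+1) / 2 ≤ swBest p R := by
  rw [swBest_eq, ← sum_bw, ← Equiv.sum_comp (R 0)]
  exact Finset.sum_le_sum fun x _ => le_max_left _ _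

lemma sum_max (p : ℕ) : ∑ k : Fin p, ∑ l : Fin p, max (bw p k) (bw p l)
    = (p : ℝ) * (p+1) * (4 * p - 1) / 6 := by
  induction p with
  | zero => simp
  | succ p ih =>
    have h0 : ∀ l, max (bw (p+1) 0) (bw (p+1) l) = (p : ℝ) + 1 := by
      intro l
      rw [max_eq_left] <;> simp [bw]
    have h0' : ∀ l, max (bw (p+1) l) (bw (p+1) 0) = (p : ℝ) + 1 := by
      intro l
      rw [max_comm, h0]
    rw [Fin.sum_univ_succ]
    have hs : ∀ k : Fin p, ∑ l, max (bw (p+1) k.succ) (bw (p+1) l)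
        = ((p : ℝ) + 1) + ∑ l, max (bw p k) (bw p l) := by
      intro k
      rw [Fin.sum_univ_succ, h0']
      simp only [← Fin.zero_succAbove, bw_succ]
    simp only [h0, hs]
    simp only [Finset.sum_add_distrib, ih]
    simp
    ring

lemma sum_perm (p : ℕ) (x : Fin (p+1)) (f : Fin (p+1) → ℝ) :
    ∑ r : Equiv.Perm (Fin (p+1)), f (r x) = (p.factorial : ℝ) * ∑ k, f k := by
  rw [← (comb_bij x).sum_comp, Fintype.sum_prod_type]
  simp [comb_self, Fintype.card_perm, Finset.mul_sum]

lemma sum_swBest (p : ℕ) (hp : 1 ≤ p) :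
    ∑ R : Fin 2 → Equiv.Perm (Fin p), swBest p R
      = (p.factorial : ℝ)^2 * (((p : ℝ)+1) * (4 * p - 1) / 6) := by
  obtain ⟨m, rfl⟩ : ∃ m, p = m + 1 := ⟨p - 1, by omega⟩
  simp only [swBest_eq]
  rw [Finset.sum_comm]
  have h : ∀ x : Fin (m+1), ∑ R : Fin 2 → Equiv.Perm (Fin (m+1)),
      max (bw (m+1) (R 0 x)) (bw (m+1) (R 1 x))
      = (m.factorial : ℝ)^2 * (((m+1 : ℕ) : ℝ) * ((m+1 : ℕ)+1) * (4 * (m+1 : ℕ) - 1) / 6) := by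
    intro x
    rw [← (piFinTwoEquiv (fun _ => Equiv.Perm (Fin (m+1)))).symm.sum_comp, Fintype.sum_prod_type]
    simp only [piFinTwoEquiv_symm_apply, Fin.cons_zero, Fin.cons_one]
    have hin : ∀ k, ∑ r : Equiv.Perm (Fin (m+1)), max (bw (m+1) k) (bw (m+1) (r x))
        = (m.factorial : ℝ) * ∑ l, max (bw (m+1) k) (bw (m+1) l) :=
      fun k => sum_perm m x (fun l => max (bw (m+1) k) (bw (m+1) l))
    simp only [hin]
    rw [sum_perm m x (fun k => (m.factorial : ℝ) * ∑ l, max (bw (m+1) k) (bw (m+1) l)),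
      ← Finset.mul_sum, sum_max]
    ring
  simp only [h]
  rw [Finset.sum_const, Nat.factorial_succ]
  simp
  ring

end SeqAlloc

open scoped Classical in
/-- For two agents, `p ≥ 1` items, Borda utilities and every `ε > 0`:
with probability at least `1 − ε` over uniform independent profiles `R`,
`z₁(R)/z₂(R) > 1 − 1/(3pε)`. -/
theorem stmt6 (p : ℕ) (hp : 1 ≤ p) (ε : ℝ) (hε : 0 < ε) :
    (1 : ℝ) - ε ≤
      ((Finset.univ.filter (fun R : Fin 2 → Equiv.Perm (Fin p) =>
          swAlt p R / swBest p R > 1 - 1 / (3 * (p : ℝ) * ε))).card : ℝ)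
        / ((p.factorial : ℝ) ^ 2) := by
  have hp0 : (0 : ℝ) < p := by exact_mod_cast hp
  have hf : (0 : ℝ) < (p.factorial : ℝ)^2 := by positivity
  set P : (Fin 2 → Equiv.Perm (Fin p)) → Prop := fun R =>
    swAlt p R / swBest p R > 1 - 1 / (3 * (p : ℝ) * ε) with hP
  have hcard : ((Finset.univ.filter P).card : ℝ) + ((Finset.univ.filter (fun R => ¬ P R)).card : ℝ)
      = (p.factorial : ℝ)^2 := by
    rw [← Nat.cast_add, Finset.card_filter_add_card_filter_not]
    simp [Fintype.card_perm]
  have hsum : ∑ R : Fin 2 → Equiv.Perm (Fin p), (swBest p R - swAlt p R)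
      ≤ (p.factorial : ℝ)^2 * (((p : ℝ) + 1) / 6) := by
    rw [Finset.sum_sub_distrib, SeqAlloc.sum_swBest p hp]
    have := SeqAlloc.sum_swAlt p
    linarith
  have hbad : ∀ R, ¬ P R → ((p : ℝ) + 1) / (6 * ε) ≤ swBest p R - swAlt p R := by
    intro R hR
    have h1 : swAlt p R / swBest p R ≤ 1 - 1 / (3 * (p : ℝ) * ε) := not_lt.1 hR
    have h2 := SeqAlloc.swBest_ge p R
    have h3 : 0 < swBest p R := lt_of_lt_of_le (by positivity) h2
    rw [div_le_iff₀ h3] at h1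
    have h4 : 1 / (3 * (p : ℝ) * ε) * ((p : ℝ) * (p+1) / 2) ≤ 1 / (3 * (p : ℝ) * ε) * swBest p R := by
      gcongr
    have h5 : 1 / (3 * (p : ℝ) * ε) * ((p : ℝ) * (p+1) / 2) = ((p : ℝ) + 1) / (6 * ε) := by
      field_simp
      norm_num
    linarith
  have hm : ((Finset.univ.filter (fun R => ¬ P R)).card : ℝ) * (((p : ℝ) + 1) / (6 * ε))
      ≤ (p.factorial : ℝ)^2 * (((p : ℝ) + 1) / 6) := by
    refine le_trans ?_ hsum
    rw [← nsmul_eq_mul]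
    refine le_trans (Finset.card_nsmul_le_sum _ (fun R => swBest p R - swAlt p R) _ ?_)
      (Finset.sum_le_sum_of_subset_of_nonneg (Finset.filter_subset _ _) ?_)
    · intro R hR
      exact hbad R (Finset.mem_filter.1 hR).2
    · intro R _ _
      exact sub_nonneg.2 (SeqAlloc.sw_le p R)
  have hB : ((Finset.univ.filter (fun R => ¬ P R)).card : ℝ) ≤ ε * (p.factorial : ℝ)^2 := by
    have h6 : ((Finset.univ.filter (fun R => ¬ P R)).card : ℝ) * (((p : ℝ) + 1) / (6 * ε))
      = ((Finset.univ.filter (fun R => ¬ P R)).card : ℝ) / ε * (((p : ℝ) + 1) / 6) := by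
      field_simp
    rw [h6] at hm
    have h7 := le_of_mul_le_mul_right hm (by positivity)
    rw [div_le_iff₀ hε] at h7
    linarith
  rw [le_div_iff₀ hf]
  linarith
end

section
/- For two agents, p items, uniform independent profiles, and any linear scoring function g(k) = αk + β with α ≤ 0 (so an item an agent ranks in position k is worth g(k) to her, while agents still pick the highest-ranked remaining item at their turns): the strictly alternating policy π* = 1212… of length p maximizes the expected utilitarian social welfare, i.e., for every policy π ∈ {1,2}^p, s̄w_g(π) ≤ s̄w_g(π*). -/
open Finset

namespace SeqAlloc

/-- Normalised expected Borda utility, computed recursively. -/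
noncomputable def nu : List (Fin 2) → Fin 2 → ℝ
  | [], _ => 0
  | a :: l, i => if a = i then ((l.length : ℝ) + 1) / (l.length + 2) * (1 + nu l i) else nu l i

/-- Weighted normalised welfare. -/
noncomputable def wv (l : List (Fin 2)) (a b : ℝ) : ℝ := a * nu l 0 + b * nu l 1

/-- Swap the two agents. -/
def flp (l : List (Fin 2)) : List (Fin 2) := l.map (fun x => 1 - x)

/-- Alternating list beginning with agent `c`. -/
def alt : ℕ → Fin 2 → List (Fin 2)
  | 0, _ => []
  | n + 1, c => c :: alt n (1 - c)

lemma alt_length (n : ℕ) (c : Fin 2) : (alt n c).length = n := by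
  induction n generalizing c with
  | zero => rfl
  | succ n ih => simp [alt, ih]

lemma flp_length (l : List (Fin 2)) : (flp l).length = l.length := by simp [flp]

lemma nu_flp (l : List (Fin 2)) (i : Fin 2) : nu (flp l) i = nu l (1 - i) := by
  induction l with
  | nil => rfl
  | cons a l ih =>
    have h : (1 - a = i) ↔ (a = 1 - i) := by clear ih; revert a i; decide
    have : flp (a :: l) = (1 - a) :: flp l := rfl
    rw [this]
    simp only [nu, ih, flp_length, h]

lemma wv_flp (l : List (Fin 2)) (a b : ℝ) : wv (flp l) a b = wv l b a := by
  simp only [wv, nu_flp]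
  have : (1 : Fin 2) - 0 = 1 := by decide
  rw [this]
  simp; ring

lemma flp_alt (n : ℕ) (c : Fin 2) : flp (alt n c) = alt n (1 - c) := by
  induction n generalizing c with
  | zero => rfl
  | succ n ih =>
    show (1 - c) :: flp (alt n (1 - c)) = _
    rw [ih]; rfl

lemma nu_nonneg (l : List (Fin 2)) (i : Fin 2) : 0 ≤ nu l i := by
  induction l with
  | nil => simp [nu]
  | cons a l ih =>
    simp only [nu]; split_ifs
    · positivity
    · exact ih

lemma wv_zero (l : List (Fin 2)) (a b : ℝ) : wv (0 :: l) a b =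
    a * (((l.length : ℝ) + 1) / (l.length + 2)) +
      wv l (a * (((l.length : ℝ) + 1) / (l.length + 2))) b := by
  simp [wv, nu]; ring

lemma wv_one (l : List (Fin 2)) (a b : ℝ) : wv (1 :: l) a b =
    b * (((l.length : ℝ) + 1) / (l.length + 2)) +
      wv l a (b * (((l.length : ℝ) + 1) / (l.length + 2))) := by
  simp [wv, nu]; ring

lemma alt_mono (n : ℕ) : nu (alt n 0) 1 ≤ nu (alt n 0) 0 := by
  induction n using Nat.strong_induction_on with
  | _ n ih =>
    match n with
    | 0 => simp [alt, nu]
    | 1 => simp [alt, nu]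
    | m + 2 =>
      have h := ih m (by omega)
      have e : alt (m+2) 0 = 0 :: 1 :: alt m 0 := rfl
      have h0 := nu_nonneg (alt m 0) 1
      rw [e]
      simp only [nu, List.length_cons, alt_length]
      simp
      have : ((m : ℝ) + 1) / (m + 2) ≤ (m + 1 + 1) / (m + 1 + 2) := by
        rw [div_le_div_iff₀ (by positivity) (by positivity)]; nlinarith
      have h2 : 0 ≤ ((m : ℝ) + 1) / (m + 2) := by positivity
      nlinarith [mul_le_mul this (add_le_add_right h 1) (by linarith) (h2.trans this)]

lemma exists_opt (n : ℕ) (a b : ℝ) : ∃ g : List (Fin 2), g.length = n ∧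
    ∀ l : List (Fin 2), l.length = n → wv l a b ≤ wv g a b := by
  have hf : {l : List (Fin 2) | l.length = n}.Finite := List.finite_length_eq _ n
  obtain ⟨g, hg, h⟩ := Set.exists_max_image _ (fun l => wv l a b) hf
    ⟨alt n 0, alt_length n 0⟩
  exact ⟨g, hg, fun l hl => h l hl⟩

/-- Picking the larger weight first is optimal. -/
def GreedyAt (t : ℕ) : Prop := ∀ a b : ℝ, 0 ≤ b → b ≤ a → ∀ l : List (Fin 2), l.length = t + 1 →
  ∃ l' : List (Fin 2), l'.length = t ∧ wv l a b ≤ wv (0 :: l') a b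

lemma region (t : ℕ) (H : ∀ s < t, GreedyAt s) : ∀ a b : ℝ, 0 ≤ b → b ≤ a →
    ((t : ℝ) + 1) * a ≤ (t + 2) * b → ∀ l : List (Fin 2), l.length = t →
    wv l a b ≤ wv (alt t 0) a b := by
  induction t with
  | zero =>
    intro a b _ _ _ l hl
    rw [List.length_eq_zero_iff.1 hl]; rfl
  | succ t ih =>
    intro a b hb hba hr l hl
    obtain ⟨l', hl', h⟩ := H t (by omega) a b hb hba l hl
    refine h.trans ?_
    have e : alt (t+1) 0 = 0 :: alt t 1 := rfl
    rw [e, wv_zero, wv_zero, hl', alt_length]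
    push_cast at hr
    set r : ℝ := ((t : ℝ) + 1) / (t + 2) with hrdef
    have hrr : r * (t + 2) = t + 1 := by rw [hrdef]; field_simp
    have hr0 : 0 ≤ r := by positivity
    have ht : (0 : ℝ) ≤ t := by positivity
    have key := ih (fun s hs => H s (by omega)) b (a * r) (mul_nonneg (hb.trans hba) hr0)
      (by
        have : (a * r) * (t+2) ≤ b * (t + 2) := by
          rw [mul_assoc, hrr]; nlinarith
        exact le_of_mul_le_mul_right this (by positivity))
      (by
        have : (t + 2) * (a * r) = a * (t + 1) := by rw [← hrr]; ring
        rw [this]; nlinarith) (flp l') (by rw [flp_length, hl'])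
    rw [wv_flp, ← wv_flp (alt t 0), flp_alt] at key
    simp at key
    linarith

lemma greedy (t : ℕ) : GreedyAt t := by
  induction t using Nat.strong_induction_on with
  | _ t ih =>
    intro a b hb hba l hl
    match l, hl with
    | c :: l, hl =>
    have hl : l.length = t := by simpa using hl
    by_cases hc : c = 0
    · exact ⟨l, hl, by rw [hc]⟩
    have hc : c = 1 := by omega
    subst hc
    match t with
    | 0 =>
      refine ⟨[], rfl, ?_⟩
      have hl0 : l = [] := List.length_eq_zero_iff.1 (by assumption)
      rw [hl0, wv_zero, wv_one]
      simp [wv, nu]; linarith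
    | m + 1 =>
      set r : ℝ := ((m : ℝ) + 1 + 1) / (m + 1 + 2) with hrdef
      set r' : ℝ := ((m : ℝ) + 1) / (m + 2) with hrdef'
      have hr0 : 0 ≤ r := by positivity
      have hr0' : 0 ≤ r' := by positivity
      have hr1 : r ≤ 1 := by rw [hrdef, div_le_one (by positivity)]; linarith
      have hrr : r' ≤ r := by
        rw [hrdef, hrdef', div_le_div_iff₀ (by positivity) (by positivity)]; nlinarith
      have ha : 0 ≤ a := hb.trans hba
      obtain ⟨l₂, hl₂, h₂⟩ := ih m (by omega) a (b * r) (by positivity) (by nlinarith) l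
        (by simpa using hl)
      obtain ⟨g, hg, hopt⟩ := exists_opt m (a * r') (b * r)
      have hg2 : wv (0 :: l₂) a (b * r) ≤ wv (0 :: g) a (b * r) := by
        rw [wv_zero, wv_zero, hl₂, hg]
        have := hopt l₂ hl₂
        linarith
      have hl' : l.length = m + 1 := by simpa using hl
      have h3 : wv (1 :: l) a b ≤ wv (1 :: 0 :: g) a b := by
        rw [wv_one, wv_one (0 :: g), hl', List.length_cons, hg]
        push_cast
        linarith
      by_cases hlt : b * r < a * r'
      · refine ⟨1 :: g, by simp [hg], h3.trans ?_⟩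
        have hs := hopt (flp g) (by rw [flp_length, hg])
        rw [wv_flp] at hs
        simp only [wv] at hs
        have hXY : nu g 1 ≤ nu g 0 := by nlinarith
        have h0 := nu_nonneg g 1
        simp only [wv, nu, List.length_cons, hg]
        push_cast
        simp
        rw [← hrdef, ← hrdef']
        have : b * (1 + nu g 1) ≤ a * (1 + nu g 0) :=
          mul_le_mul hba (by linarith) (by linarith) ha
        nlinarith [mul_nonneg (sub_nonneg.2 hrr) (sub_nonneg.2 this)]
      · push Not at hlt
        have hreg := region m (fun s hs => ih s (by omega)) (b * r) (a * r') (by positivity) hlt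
          (by
            have e1 : r = r' * (((m:ℝ)+2)^2 / ((m+1)*(m+3))) := by
              rw [hrdef, hrdef']; field_simp; ring
            have e2 : ((m:ℝ)+1) * (((m:ℝ)+2)^2 / ((m+1)*(m+3))) ≤ m + 2 := by
              rw [mul_div_assoc', div_le_iff₀ (by positivity)]
              have : (0:ℝ) ≤ m := by positivity
              nlinarith [mul_nonneg this this, mul_nonneg (mul_nonneg this this) this]
            calc ((m:ℝ)+1) * (b * r) ≤ (m+1) * (a * r) := by gcongr
              _ = (a * r') * (((m:ℝ)+1) * (((m:ℝ)+2)^2 / ((m+1)*(m+3)))) := by rw [e1]; ring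
              _ ≤ (a * r') * (m + 2) := by gcongr
              _ = _ := by ring) (flp g) (by rw [flp_length, hg])
        rw [wv_flp, ← wv_flp (alt m 0), flp_alt] at hreg
        simp at hreg
        refine ⟨alt (m+1) 1, alt_length _ _, h3.trans ?_⟩
        have h4 : wv (1 :: 0 :: g) a b ≤ wv (alt (m+2) 1) a b := by
          have e : alt (m+2) 1 = 1 :: 0 :: alt m 1 := rfl
          rw [e, wv_one, wv_one, wv_zero, wv_zero]
          simp only [List.length_cons, hg, alt_length]
          push_cast
          rw [← hrdef, ← hrdef']
          linarith
        refine h4.trans ?_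
        have e : (0 :: alt (m+1) 1) = alt (m+2) 0 := rfl
        rw [e]
        have e' : alt (m+2) 1 = flp (alt (m+2) 0) := by rw [flp_alt]; rfl
        rw [e', wv_flp]
        have := alt_mono (m+2)
        simp only [wv]
        nlinarith

lemma alt_opt (l : List (Fin 2)) :
    nu l 0 + nu l 1 ≤ nu (alt l.length 0) 0 + nu (alt l.length 0) 1 := by
  have := region l.length (fun s _ => greedy s) 1 1 (by norm_num) le_rfl (by linarith) l rfl
  simpa [wv] using this

end SeqAlloc

namespace SeqAlloc

/-- Extend a ranking of `p` items by an item `y` put at rank `ρ`. -/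
def ext {p : ℕ} (y ρ : Fin (p+1)) (σ : Equiv.Perm (Fin p)) : Equiv.Perm (Fin (p+1)) :=
  (finSuccEquiv' y).trans ((Equiv.optionCongr σ).trans (finSuccEquiv' ρ).symm)

lemma ext_self {p : ℕ} (y ρ : Fin (p+1)) (σ : Equiv.Perm (Fin p)) : ext y ρ σ y = ρ := by
  simp [ext]

lemma ext_succAbove {p : ℕ} (y ρ : Fin (p+1)) (σ : Equiv.Perm (Fin p)) (x : Fin p) :
    ext y ρ σ (y.succAbove x) = ρ.succAbove (σ x) := by
  simp [ext]

lemma ext_inj {p : ℕ} (y ρ : Fin (p+1)) (σ τ : Equiv.Perm (Fin p)) (h : ext y ρ σ = ext y ρ τ) :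
    σ = τ := by
  ext1 x
  have := DFunLike.congr_fun h (y.succAbove x)
  rw [ext_succAbove, ext_succAbove] at this
  exact Fin.succAbove_right_injective this

/-- Decomposition of profiles after the first pick, by agent `a`. -/
def prof {p : ℕ} (a : Fin 2) (z : Fin (p+1) × Fin (p+1) × (Fin 2 → Equiv.Perm (Fin p))) :
    Fin 2 → Equiv.Perm (Fin (p+1)) :=
  fun i => ext z.1 (if i = a then 0 else z.2.1) (z.2.2 i)

lemma prof_bij {p : ℕ} (a : Fin 2) : Function.Bijective (prof (p := p) a) := by
  rw [Fintype.bijective_iff_injective_and_card]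
  constructor
  · rintro ⟨y, ρ, R⟩ ⟨y', ρ', R'⟩ h
    have h1 := congr_fun h a
    simp only [prof, if_true] at h1
    have hy : y = y' := by
      have e1 : ext y 0 (R a) y = 0 := ext_self _ _ _
      have e2 : ext y' 0 (R' a) y' = 0 := ext_self _ _ _
      rw [h1] at e1
      exact (Equiv.injective _) (e1.trans e2.symm)
    subst hy
    have hne : (1 - a) ≠ a := by clear h h1; revert a; decide
    have h2 := congr_fun h (1 - a)
    simp only [prof, if_neg hne] at h2
    have hρ : ρ = ρ' := by
      have := DFunLike.congr_fun h2 y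
      rwa [ext_self, ext_self] at this
    subst hρ
    have hR : R = R' := by
      funext i
      exact ext_inj _ _ _ _ (congr_fun h i)
    rw [hR]
  · simp [Fintype.card_perm, Nat.factorial_succ]; ring

lemma allocList_map_s8 {n p q : ℕ} (R : Fin n → Equiv.Perm (Fin p)) (Q : Fin n → Equiv.Perm (Fin q))
    (e : Fin p ↪ Fin q) (φ : Fin n → Fin p → Fin q) (hφ : ∀ i, Monotone (φ i))
    (hQ : ∀ i x, Q i (e x) = φ i (R i x)) (π : List (Fin n)) (S : Finset (Fin p)) :
    allocList Q π (S.map e) = (allocList R π S).map (fun x => (x.1, e x.2)) := by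
  induction π generalizing S with
  | nil => rfl
  | cons a π ih =>
    by_cases h : S.Nonempty
    · have h' : (S.map e).Nonempty := h.map
      have hp : pickItem (Q a) (S.map e) h' = e (pickItem (R a) S h) := by
        apply pickItem_eq
        · exact Finset.mem_map_of_mem _ (pickItem_mem _ _ _)
        · intro y hy
          obtain ⟨z, hz, rfl⟩ := Finset.mem_map.1 hy
          rw [hQ, hQ]
          exact hφ a (pickItem_le _ _ _ _ hz)
      simp only [allocList, dif_pos h, dif_pos h', hp, List.map_cons]
      rw [← Finset.map_erase, ih]
    · have h' : ¬ (S.map e).Nonempty := by simpa using h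
      simp only [allocList, dif_neg h, dif_neg h', List.map_nil]

lemma alloc_prof {p : ℕ} (a : Fin 2) (π : List (Fin 2)) (y ρ : Fin (p+1))
    (R : Fin 2 → Equiv.Perm (Fin p)) :
    allocList (prof a (y, ρ, R)) (a :: π) Finset.univ =
      (a, y) :: (allocList R π Finset.univ).map (fun x => (x.1, y.succAbove x.2)) := by
  have h : (Finset.univ : Finset (Fin (p+1))).Nonempty := Finset.univ_nonempty
  have hy : prof a (y, ρ, R) a y = 0 := by simp [prof, ext_self]
  have hp : pickItem (prof a (y, ρ, R) a) Finset.univ h = y := by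
    apply pickItem_eq _ _ _ _ (Finset.mem_univ _)
    intro z _
    rw [hy]; exact Fin.zero_le _
  simp only [allocList, dif_pos h, hp]
  have he : (Finset.univ : Finset (Fin (p+1))).erase y =
      (Finset.univ : Finset (Fin p)).map (Fin.succAboveEmb y) := by
    ext z
    simp [Fin.exists_succAbove_eq_iff]
  rw [he, allocList_map_s8 R (prof a (y, ρ, R)) (Fin.succAboveEmb y)
    (fun i => (if i = a then 0 else ρ).succAbove)
    (fun i => (Fin.strictMono_succAbove _).monotone)]
  · rfl
  · intro i x
    exact ext_succAbove _ _ _ _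

lemma sum_list_comm {ι β : Type*} (s : Finset ι) (l : List β) (f : ι → β → ℝ) :
    ∑ i ∈ s, (l.map (f i)).sum = (l.map (fun x => ∑ i ∈ s, f i x)).sum := by
  induction l with
  | nil => simp
  | cons b l ih => simp [Finset.sum_add_distrib, ih]

lemma sum_succAbove {p : ℕ} (k : Fin p) :
    ∑ ρ : Fin (p+1), (((p+1 : ℕ) : ℝ) - (((ρ.succAbove k).val + 1 : ℕ) : ℝ) + 1) =
      (p + 2) * ((p : ℝ) - ((k.val + 1 : ℕ) : ℝ) + 1) := by
  have h : ∀ ρ : Fin (p+1), ((ρ.succAbove k).val : ℝ) = k.val + if ρ ≤ k.castSucc then 1 else 0 := by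
    intro ρ
    rw [Fin.succAbove]
    by_cases hh : k.castSucc < ρ
    · simp [hh]
    · simp [hh, not_lt.1 hh]
  have hc : ∑ ρ : Fin (p+1), (if ρ ≤ k.castSucc then (1:ℝ) else 0) = k.val + 1 := by
    rw [Finset.sum_boole]
    have : (Finset.univ.filter (fun ρ : Fin (p+1) => ρ ≤ k.castSucc)) = Finset.Iic k.castSucc := by
      ext; simp
    rw [this, Fin.card_Iic]; simp
  push_cast
  simp only [h]
  simp only [Finset.sum_add_distrib, Finset.sum_sub_distrib, hc]
  simp
  ring

/-- Total Borda utility of agent `i`. -/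
noncomputable def tot (p : ℕ) (π : List (Fin 2)) (i : Fin 2) : ℝ :=
  ∑ R : Fin 2 → Equiv.Perm (Fin p), utilAgent (fun k => (p : ℝ) - k + 1) R π i

lemma tot_eq (π : List (Fin 2)) (i : Fin 2) :
    tot π.length π i = ((π.length.factorial : ℝ)^2) * (π.length + 1) * nu π i := by
  induction π with
  | nil => simp [tot, utilAgent, allocList, nu]
  | cons a π ih =>
    set p := π.length with hp
    have h1 : tot (p+1) (a :: π) i = ∑ y : Fin (p+1), ∑ ρ : Fin (p+1),
        ∑ R : Fin 2 → Equiv.Perm (Fin p),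
          utilAgent (fun k => ((p+1 : ℕ) : ℝ) - k + 1) (prof a (y, ρ, R)) (a :: π) i := by
      unfold tot
      rw [← (prof_bij a).sum_comp, Fintype.sum_prod_type]
      simp_rw [Fintype.sum_prod_type]
    have hl : (a :: π).length = p + 1 := rfl
    rw [hl, h1]
    simp only [nu]
    rw [← hp, Nat.factorial_succ]
    push_cast
    have hcard : (Fintype.card (Fin 2 → Equiv.Perm (Fin p)) : ℝ) = (p.factorial : ℝ)^2 := by
      simp [Fintype.card_perm]
    by_cases hai : a = i
    · subst hai
      have h2 : ∀ (y ρ : Fin (p+1)) (R : Fin 2 → Equiv.Perm (Fin p)),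
          utilAgent (fun k => ((p+1 : ℕ) : ℝ) - k + 1) (prof a (y, ρ, R)) (a :: π) a
          = (p + 1) + utilAgent (fun k => (p : ℝ) - k + 1) R π a := by
        intro y ρ R
        unfold utilAgent
        rw [alloc_prof]
        simp only [List.map_cons, List.sum_cons, List.map_map, if_true]
        congr 1
        · simp [prof, ext_self]
        · congr 2
          funext x
          simp only [Function.comp]
          split_ifs with hx
          · simp [prof, ext_succAbove]
          · rfl
      push_cast at h2
      simp_rw [h2, Finset.sum_add_distrib]
      have : ∑ R : Fin 2 → Equiv.Perm (Fin p), utilAgent (fun k => (p : ℝ) - k + 1) R π a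
        = tot p π a := rfl
      rw [this, ih]
      simp only [Finset.sum_const, Finset.card_univ, nsmul_eq_mul, hcard, if_true, Fintype.card_fin]
      push_cast
      field_simp
      ring
    · have h2 : ∀ (y : Fin (p+1)) (R : Fin 2 → Equiv.Perm (Fin p)), ∑ ρ : Fin (p+1),
          utilAgent (fun k => ((p+1 : ℕ) : ℝ) - k + 1) (prof a (y, ρ, R)) (a :: π) i
          = (p + 2) * utilAgent (fun k => (p : ℝ) - k + 1) R π i := by
        intro y R
        unfold utilAgent
        simp_rw [alloc_prof]
        simp only [List.map_cons, List.sum_cons, List.map_map, if_neg hai, zero_add]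
        rw [sum_list_comm, ← List.sum_map_mul_left]
        congr 2
        funext x
        simp only [Function.comp]
        split_ifs with hx
        · have := sum_succAbove (R i x.2)
          rw [← this]
          apply Finset.sum_congr rfl
          intro ρ _
          simp [prof, ext_succAbove, Ne.symm hai]
        · simp
      push_cast at h2
      rw [Finset.sum_congr rfl (fun y _ => Finset.sum_comm)]
      simp_rw [h2, ← Finset.mul_sum]
      have : ∑ R : Fin 2 → Equiv.Perm (Fin p), utilAgent (fun k => (p : ℝ) - k + 1) R π i
        = tot p π i := rfl
      rw [this, ih]
      simp only [Finset.sum_const, Finset.card_univ, nsmul_eq_mul, if_neg hai, Fintype.card_fin]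
      push_cast
      ring

lemma alloc_length {n p : ℕ} (R : Fin n → Equiv.Perm (Fin p)) (π : List (Fin n))
    (S : Finset (Fin p)) (h : π.length ≤ S.card) : (allocList R π S).length = π.length := by
  induction π generalizing S with
  | nil => rfl
  | cons a π ih =>
    have hS : S.Nonempty := by
      rw [← Finset.card_pos]; simp at h; omega
    simp only [allocList, dif_pos hS, List.length_cons]
    rw [ih]
    rw [Finset.card_erase_of_mem (pickItem_mem _ _ _)]
    simp at h; omega

lemma util_sum {p : ℕ} (α β : ℝ) (R : Fin 2 → Equiv.Perm (Fin p)) (π : List (Fin 2))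
    (h : π.length = p) :
    utilAgent (fun k => α * k + β) R π 0 + utilAgent (fun k => α * k + β) R π 1 =
    (-α) * (utilAgent (fun k => (p : ℝ) - k + 1) R π 0 + utilAgent (fun k => (p : ℝ) - k + 1) R π 1)
      + p * (α * (p + 1) + β) := by
  have hl := alloc_length R π Finset.univ (by simp [h])
  rw [h] at hl
  have : (p : ℝ) = ((allocList R π Finset.univ).length : ℝ) := by rw [hl]
  have gen : ∀ (L : List (Fin 2 × Fin p)),
      (L.map (fun x => if x.1 = 0 then α * ((((R 0) x.2).val + 1 : ℕ) : ℝ) + β else 0)).sum +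
      (L.map (fun x => if x.1 = 1 then α * ((((R 1) x.2).val + 1 : ℕ) : ℝ) + β else 0)).sum =
      (-α) * ((L.map (fun x => if x.1 = 0 then (p : ℝ) - ((((R 0) x.2).val + 1 : ℕ) : ℝ) + 1 else 0)).sum +
      (L.map (fun x => if x.1 = 1 then (p : ℝ) - ((((R 1) x.2).val + 1 : ℕ) : ℝ) + 1 else 0)).sum)
      + L.length * (α * (p + 1) + β) := by
    intro L
    induction L with
    | nil => simp
    | cons x L ih =>
      obtain ⟨c, x⟩ := x
      simp only [List.map_cons, List.sum_cons, List.length_cons]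
      push_cast at ih ⊢
      have hc : c = 0 ∨ c = 1 := by omega
      rcases hc with rfl | rfl
      · simp only [if_true, zero_ne_one, if_false]
        linarith
      · simp only [if_true, one_ne_zero, if_false]
        linarith
  have := gen (allocList R π Finset.univ)
  rw [hl] at this
  exact this

lemma welfare_eq (α β : ℝ) (π : List (Fin 2)) (p : ℕ) (h : π.length = p) :
    expectedUtil 2 p (fun k => α * k + β) π 0 + expectedUtil 2 p (fun k => α * k + β) π 1 =
    (-α) * (p + 1) * (nu π 0 + nu π 1) + p * (α * (p + 1) + β) := by
  unfold expectedUtil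
  rw [← add_div, ← Finset.sum_add_distrib]
  simp_rw [util_sum α β _ π h]
  rw [Finset.sum_add_distrib, ← Finset.mul_sum, Finset.sum_add_distrib]
  have h0 := tot_eq π 0
  have h1 := tot_eq π 1
  unfold tot at h0 h1
  rw [h] at h0 h1
  rw [h0, h1]
  have hf : (p.factorial : ℝ) ≠ 0 := by positivity
  simp only [Finset.sum_const, Finset.card_univ, nsmul_eq_mul]
  simp [Fintype.card_perm]
  field_simp

lemma altPolicy_eq (p : ℕ) : altPolicy p = alt p 0 := by
  have gen : ∀ p : ℕ, ∀ c : Fin 2, alt p c =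
      (List.range p).map (fun k => if k % 2 = 0 then c else 1 - c) := by
    intro p
    induction p with
    | zero => intro c; rfl
    | succ p ih =>
      intro c
      rw [List.range_succ_eq_map]
      simp only [alt, List.map_cons, List.map_map, ih]
      congr 1
      apply List.map_congr_left
      intro k _
      simp only [Function.comp]
      rcases Nat.mod_two_eq_zero_or_one k with hk | hk
      · have : (k.succ) % 2 = 1 := by omega
        simp [hk, this]
      · have : (k.succ) % 2 = 0 := by omega
        simp [hk, this]
  rw [gen]; rfl

end SeqAlloc

/-- For two agents, `p` items, uniform independent profiles and any
linear scoring function `g(k) = αk + β` with `α ≤ 0` (agents still pick their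
highest-ranked remaining item), the strictly alternating policy `π* = 1212…` of
length `p` maximizes the expected utilitarian social welfare:
`s̄w_g(π) ≤ s̄w_g(π*)` for every policy `π ∈ {1,2}^p`. -/
theorem stmt8 (p : ℕ) (α β : ℝ) (hα : α ≤ 0) (π : List (Fin 2)) (hlen : π.length = p) :
    SeqAlloc.expectedUtil 2 p (fun k => α * k + β) π 0
        + SeqAlloc.expectedUtil 2 p (fun k => α * k + β) π 1
      ≤ SeqAlloc.expectedUtil 2 p (fun k => α * k + β) (SeqAlloc.altPolicy p) 0
        + SeqAlloc.expectedUtil 2 p (fun k => α * k + β) (SeqAlloc.altPolicy p) 1 := by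

  have hal : (SeqAlloc.altPolicy p).length = p := by
    rw [SeqAlloc.altPolicy_eq, SeqAlloc.alt_length]
  rw [SeqAlloc.welfare_eq α β π p hlen, SeqAlloc.welfare_eq α β _ p hal, SeqAlloc.altPolicy_eq]
  have h := SeqAlloc.alt_opt π
  rw [hlen] at h
  have h2 : 0 ≤ (-α) * ((p : ℝ) + 1) := mul_nonneg (by linarith) (by positivity)
  linarith [mul_le_mul_of_nonneg_left h h2]
end
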